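/- For n ≥ 1, let μ(f) denote the Lebesgue measure of { t ∈ [0, 2π) : |f(t)| ≥ 1 } for a real trigonometric polynomial f of degree n with leading harmonic a_n cos nt + b_n sin nt, a_n² + b_n² > 0. Then the least constant β_n such that μ(a_n cos nt + b_n sin nt) ≤ β_n · μ(f) for all such f is β_n = √(2n). -/

import Mathlib

open Real MeasureTheory

theorem mul_sin_mul_cos_le {s x : ℝ} (hs : 1 ≤ s) (hx : 0 ≤ x) (hsx : s * x ≤ π / 2) :
    s * (sin x * cos (s * x)) ≤ sin (s * x) * cos x := by
  let g : ℝ → ℝ := fun y => sin (s * y) * cos y - s * (sin y * cos (s * y))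
  have hd : ∀ y, HasDerivAt g ((s ^ 2 - 1) * (sin y * sin (s * y))) y := by
    intro y
    have hl : HasDerivAt (fun y : ℝ => s * y) s y := by
      simpa using (hasDerivAt_id y).const_mul s
    have := ((hl.sin).mul (hasDerivAt_cos y)).sub
      (((hasDerivAt_sin y).mul hl.cos).const_mul s)
    exact this.congr_deriv (by ring)
  have hmono : MonotoneOn g (Set.Icc 0 x) := by
    refine monotoneOn_of_hasDerivWithinAt_nonneg (convex_Icc 0 x)
      (fun y _ => (hd y).continuousAt.continuousWithinAt)
      (fun y _ => (hd y).hasDerivWithinAt) ?_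
    intro y hy
    rw [interior_Icc] at hy
    have h1 : s * y ≤ s * x := mul_le_mul_of_nonneg_left hy.2.le (by linarith)
    have h2 : y ≤ s * y := by nlinarith [hy.1]
    have h3 : 0 ≤ sin y := sin_nonneg_of_nonneg_of_le_pi hy.1.le (by linarith [pi_pos])
    have h4 : 0 ≤ sin (s * y) :=
      sin_nonneg_of_nonneg_of_le_pi (by linarith [hy.1]) (by linarith [pi_pos])
    have : 0 ≤ s ^ 2 - 1 := by nlinarith
    positivity
  have := hmono (Set.left_mem_Icc.2 hx) (Set.right_mem_Icc.2 hx) hx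
  simp only [g, mul_zero, sin_zero, zero_mul, sub_zero] at this
  linarith

theorem cos_sqrt_mul_le_cos_pow {m : ℕ} (hm : 1 ≤ m) {x : ℝ} (hx : 0 ≤ x)
    (hmx : √m * x ≤ π / 2) : cos (√m * x) ≤ cos x ^ m := by
  set s : ℝ := √m with hs_def
  have hm' : (1 : ℝ) ≤ m := by exact_mod_cast hm
  have hs : 1 ≤ s := by rw [hs_def]; exact Real.one_le_sqrt.2 hm'
  have hss : s * s = m := Real.mul_self_sqrt (by positivity)
  rcases hx.eq_or_lt with rfl | hx0
  · simp
  have hxle : x ≤ s * x := by nlinarith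
  rcases hmx.eq_or_lt with heq | hlt
  · rw [heq, cos_pi_div_two]
    exact pow_nonneg (cos_nonneg_of_mem_Icc ⟨by linarith [pi_pos], by linarith⟩) _
  have hpos : ∀ y ∈ Set.Icc 0 x, 0 < cos y ∧ 0 < cos (s * y) := by
    intro y hy
    have h1 : s * y ≤ s * x := mul_le_mul_of_nonneg_left hy.2 (by linarith)
    have h2 : 0 ≤ s * y := by nlinarith [hy.1]
    exact ⟨cos_pos_of_mem_Ioo ⟨by linarith [pi_pos, hy.1], by linarith [hy.2]⟩,
      cos_pos_of_mem_Ioo ⟨by linarith [pi_pos, hy.1], by linarith [hy.2]⟩⟩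
  let g : ℝ → ℝ := fun y => m * log (cos y) - log (cos (s * y))
  have hd : ∀ y ∈ Set.Icc 0 x,
      HasDerivAt g (m * (-sin y / cos y) - (-sin (s * y) * s) / cos (s * y)) y := by
    intro y hy
    have hl : HasDerivAt (fun y : ℝ => s * y) s y := by
      simpa using (hasDerivAt_id y).const_mul s
    exact (((hasDerivAt_cos y).log (hpos y hy).1.ne').const_mul _).sub
      (hl.cos.log (hpos y hy).2.ne')
  have hmono : MonotoneOn g (Set.Icc 0 x) := by
    refine monotoneOn_of_hasDerivWithinAt_nonneg (convex_Icc 0 x)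
      (fun y hy => (hd y hy).continuousAt.continuousWithinAt)
      (fun y hy => (hd y (interior_subset hy)).hasDerivWithinAt) ?_
    intro y hy
    have hy' := interior_subset hy
    obtain ⟨hc, hcs⟩ := hpos y hy'
    have h1 : s * y ≤ s * x := mul_le_mul_of_nonneg_left hy'.2 (by linarith)
    have key := mul_sin_mul_cos_le hs hy'.1 (h1.trans hmx)
    have : m * (-sin y / cos y) - (-sin (s * y) * s) / cos (s * y) =
        s * (sin (s * y) * cos y - s * (sin y * cos (s * y))) / (cos y * cos (s * y)) := by
      rw [← hss]; field_simp; ring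
    rw [this]
    have : 0 ≤ sin (s * y) * cos y - s * (sin y * cos (s * y)) := by linarith
    positivity
  have := hmono (Set.left_mem_Icc.2 hx) (Set.right_mem_Icc.2 hx) hx
  simp only [g, mul_zero, cos_zero, log_one, sub_zero] at this
  have hp := hpos x (Set.right_mem_Icc.2 hx)
  rw [← Real.log_le_log_iff hp.2 (pow_pos hp.1 _), Real.log_pow]
  linarith

open Polynomial in
theorem Polynomial.exists_eval_cos_eq_sum (n : ℕ) (q : ℝ[X]) (hq : q.natDegree ≤ n) :
    ∃ a : ℕ → ℝ, (1 ≤ n → a n = q.coeff n / 2 ^ (n - 1)) ∧ ∀ t : ℝ,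
      q.eval (cos t) = a 0 / 2 + ∑ k ∈ Finset.Icc 1 n, a k * cos (k * t) := by
  induction n generalizing q with
  | zero =>
    refine ⟨fun _ => 2 * q.coeff 0, by simp, fun t => ?_⟩
    rw [eq_C_of_natDegree_le_zero hq]
    simp
  | succ n ih =>
    set d : ℝ := q.coeff (n + 1) / 2 ^ n with hd
    have hT : (Chebyshev.T ℝ ((n + 1 : ℕ) : ℤ)).coeff (n + 1) = 2 ^ n := by
      have h1 := Chebyshev.leadingCoeff_T ℝ ((n + 1 : ℕ) : ℤ)
      rw [leadingCoeff, Chebyshev.natDegree_T, Int.natAbs_natCast] at h1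
      simpa using h1
    have hdeg : (q - C d * Chebyshev.T ℝ ((n + 1 : ℕ) : ℤ)).natDegree ≤ n := by
      rw [natDegree_le_iff_coeff_eq_zero]
      intro N hN
      rcases (Nat.succ_le_of_lt hN).eq_or_lt with rfl | hN'
      · rw [coeff_sub, coeff_C_mul, hT, hd]
        field_simp
        simp
      · rw [coeff_sub, coeff_C_mul, coeff_eq_zero_of_natDegree_lt (by omega),
          coeff_eq_zero_of_natDegree_lt (by
            rw [Chebyshev.natDegree_T, Int.natAbs_natCast]; exact hN')]
        simp
    obtain ⟨a, -, ha⟩ := ih _ hdeg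
    refine ⟨fun k => if k = n + 1 then d else a k, by simp [hd], fun t => ?_⟩
    have h1 := ha t
    rw [eval_sub, eval_mul, eval_C, Chebyshev.T_real_cos] at h1
    rw [Finset.sum_Icc_succ_top (by omega)]
    have h2 : ∑ k ∈ Finset.Icc 1 n, (if k = n + 1 then d else a k) * cos (k * t) =
        ∑ k ∈ Finset.Icc 1 n, a k * cos (k * t) :=
      Finset.sum_congr rfl fun k hk => by
        rw [if_neg (by have := (Finset.mem_Icc.1 hk).2; omega)]
    simp only [h2, if_true]
    rw [if_neg (by omega)]
    push_cast at h1 ⊢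
    linarith

theorem continuous_poissonKernel_circleMap {w : ℂ} (hw : ‖w‖ ≠ 1) :
    Continuous fun t : ℝ => poissonKernel 0 w (circleMap 0 1 t) := by
  unfold poissonKernel
  refine Continuous.div (by fun_prop) (by fun_prop) fun t ht => hw ?_
  have h : circleMap 0 1 t = w := by simpa [sub_eq_zero] using ht
  rw [← h]; simp

theorem setIntegral_poissonKernel_circleMap {w : ℂ} (hw : ‖w‖ < 1) :
    ∫ t in Set.Ico 0 (2 * π), poissonKernel 0 w (circleMap 0 1 t) = 2 * π := by
  have h := (diffContOnCl_const (c := (1 : ℂ)) (s := Metric.ball (0 : ℂ) 1) (𝕜 := ℂ)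
    ).circleAverage_poissonKernel_smul (w := w) (by simpa using hw)
  have h2 : ∫ t in (0 : ℝ)..2 * π, ((poissonKernel 0 w (circleMap 0 1 t) : ℝ) : ℂ) = 2 * π := by
    have hpi : ((2 * π : ℝ) : ℂ) ≠ 0 := by
      exact_mod_cast (by positivity : (2 * π : ℝ) ≠ 0)
    rw [circleAverage_def] at h
    simp only [Pi.smul_apply', Complex.real_smul, mul_one] at h
    rw [Complex.ofReal_inv, inv_mul_eq_one₀ hpi] at h
    rw [← h]; push_cast; rfl
  rw [intervalIntegral.integral_ofReal] at h2
  rw [integral_Ico_eq_integral_Ioc, ← intervalIntegral.integral_of_le (by positivity)]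
  exact_mod_cast h2

theorem poissonKernel_inv_conj {w ζ : ℂ} (hw : w ≠ 0) (hζ : ‖ζ‖ = 1) :
    poissonKernel 0 (starRingEnd ℂ w)⁻¹ ζ = -poissonKernel 0 w ζ := by
  have hw' : ‖w‖ ≠ 0 := by simpa using hw
  have hcw : starRingEnd ℂ w ≠ 0 := by simpa using hw
  have h1 : ‖ζ - (starRingEnd ℂ w)⁻¹‖ = ‖ζ - w‖ / ‖w‖ := by
    rw [eq_div_iff hw']
    have hz : ζ * starRingEnd ℂ ζ = 1 := by
      rw [Complex.mul_conj, Complex.normSq_eq_norm_sq, hζ]; simp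
    calc ‖ζ - (starRingEnd ℂ w)⁻¹‖ * ‖w‖
        = ‖(ζ - (starRingEnd ℂ w)⁻¹) * starRingEnd ℂ w‖ := by rw [norm_mul, Complex.norm_conj]
      _ = ‖ζ * starRingEnd ℂ (w - ζ)‖ := by
        rw [map_sub, mul_sub, hz, sub_mul, inv_mul_cancel₀ hcw]
      _ = ‖ζ - w‖ := by rw [norm_mul, Complex.norm_conj, hζ, one_mul, norm_sub_rev]
  rw [poissonKernel, poissonKernel]
  simp only [sub_zero, h1, hζ, norm_inv, Complex.norm_conj]
  rcases eq_or_ne ‖ζ - w‖ 0 with h0 | h0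
  · simp [h0]
  field_simp
  ring

theorem abs_setIntegral_poissonKernel_le {S : Set ℝ}
    (hS' : S ⊆ Set.Ico 0 (2 * π)) (w : ℂ) :
    |∫ t in S, poissonKernel 0 w (circleMap 0 1 t)| ≤ 2 * π := by
  rcases lt_trichotomy ‖w‖ 1 with hw | hw | hw
  · have hnn : ∀ t, 0 ≤ poissonKernel 0 w (circleMap 0 1 t) := fun t => by
      unfold poissonKernel
      refine div_nonneg ?_ (by positivity)
      have := norm_nonneg w
      simp only [sub_zero, norm_circleMap_zero, abs_one]
      nlinarith
    rw [abs_of_nonneg (integral_nonneg hnn), ← setIntegral_poissonKernel_circleMap hw]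
    refine setIntegral_mono_set ?_ (Filter.Eventually.of_forall hnn) hS'.eventuallyLE
    exact ((continuous_poissonKernel_circleMap hw.ne).integrableOn_Icc).mono_set
      Set.Ico_subset_Icc_self
  · have : ∀ t, poissonKernel 0 w (circleMap 0 1 t) = 0 := fun t => by
      simp [poissonKernel, hw]
    simp only [this, integral_zero, abs_zero]
    positivity
  · have hw0 : w ≠ 0 := by rintro rfl; simp at hw; linarith
    have hlt : ‖(starRingEnd ℂ w)⁻¹‖ < 1 := by
      rw [norm_inv, Complex.norm_conj]; exact inv_lt_one_of_one_lt₀ hw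
    have hnn : ∀ t, 0 ≤ poissonKernel 0 (starRingEnd ℂ w)⁻¹ (circleMap 0 1 t) := fun t => by
      unfold poissonKernel
      refine div_nonneg ?_ (by positivity)
      have := norm_nonneg (starRingEnd ℂ w)⁻¹
      simp only [sub_zero, norm_circleMap_zero, abs_one]
      nlinarith
    have he : ∀ t, poissonKernel 0 w (circleMap 0 1 t) =
        -poissonKernel 0 (starRingEnd ℂ w)⁻¹ (circleMap 0 1 t) := fun t => by
      rw [poissonKernel_inv_conj hw0 (by simp), neg_neg]
    simp only [he]
    rw [integral_neg, abs_neg, abs_of_nonneg (integral_nonneg hnn),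
      ← setIntegral_poissonKernel_circleMap hlt]
    refine setIntegral_mono_set ?_ (Filter.Eventually.of_forall hnn) hS'.eventuallyLE
    exact ((continuous_poissonKernel_circleMap hlt.ne).integrableOn_Icc).mono_set
      Set.Ico_subset_Icc_self

/-- The Herglotz transform of the indicator of the arc set parametrized by `S`. -/
noncomputable def herglotzTransform (S : Set ℝ) (w : ℂ) : ℂ :=
  ∫ t in S, herglotzRieszKernel 0 w (circleMap 0 1 t)

section
variable {S : Set ℝ} {K : Set ℂ} {w : ℂ}

theorem exists_forall_le_norm_circleMap_sub (hK : IsClosed K)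
    (hSK : ∀ t ∈ S, circleMap 0 1 t ∈ K) (hw : w ∉ K) :
    ∃ d > 0, ∀ x ∈ Metric.ball w d, ∀ t ∈ S, d ≤ ‖circleMap 0 1 t - x‖ := by
  obtain ⟨ε, hε, hball⟩ := Metric.isOpen_iff.1 hK.isOpen_compl w hw
  refine ⟨ε / 2, by positivity, fun x hx t ht => ?_⟩
  by_contra! h
  refine hball ?_ (hSK t ht)
  rw [Metric.mem_ball, dist_eq_norm] at hx ⊢
  calc ‖circleMap 0 1 t - w‖ = ‖(circleMap 0 1 t - x) + (x - w)‖ := by congr 1; ring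
    _ ≤ ‖circleMap 0 1 t - x‖ + ‖x - w‖ := norm_add_le _ _
    _ < ε := by linarith

theorem measurable_herglotzRieszKernel_circleMap (w : ℂ) :
    Measurable fun t : ℝ => herglotzRieszKernel 0 w (circleMap 0 1 t) := by
  unfold herglotzRieszKernel
  have := (continuous_circleMap 0 1).measurable
  fun_prop

theorem integrableOn_herglotzRieszKernel (hS : MeasurableSet S)
    (hS' : S ⊆ Set.Ico 0 (2 * π)) (hK : IsClosed K)
    (hSK : ∀ t ∈ S, circleMap 0 1 t ∈ K) (hw : w ∉ K) :
    IntegrableOn (fun t => herglotzRieszKernel 0 w (circleMap 0 1 t)) S := by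
  obtain ⟨d, hd, h⟩ := exists_forall_le_norm_circleMap_sub hK hSK hw
  have hfin : volume S < ⊤ := (measure_mono hS').trans_lt measure_Ico_lt_top
  refine Measure.integrableOn_of_bounded hfin.ne
    (measurable_herglotzRieszKernel_circleMap w).aestronglyMeasurable (M := (1 + ‖w‖) / d) ?_
  filter_upwards [ae_restrict_mem hS] with t ht
  rw [herglotzRieszKernel, norm_div]
  simp only [sub_zero]
  refine div_le_div₀ (by positivity) ((norm_add_le _ _).trans (by simp)) hd
    (h w (Metric.mem_ball_self hd) t ht)

theorem differentiableAt_herglotzTransform (hS : MeasurableSet S)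
    (hS' : S ⊆ Set.Ico 0 (2 * π)) (hK : IsClosed K)
    (hSK : ∀ t ∈ S, circleMap 0 1 t ∈ K) (hw : w ∉ K) :
    DifferentiableAt ℂ (herglotzTransform S) w := by
  obtain ⟨d, hd, h⟩ := exists_forall_le_norm_circleMap_sub hK hSK hw
  have hfin : volume S < ⊤ := (measure_mono hS').trans_lt measure_Ico_lt_top
  have hcm := (continuous_circleMap 0 1).measurable
  refine (hasDerivAt_integral_of_dominated_loc_of_deriv_le
    (F' := fun x t => 2 * circleMap 0 1 t / (circleMap 0 1 t - x) ^ 2)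
    (bound := fun _ => 2 / d ^ 2) (Metric.ball_mem_nhds w hd)
    (Filter.Eventually.of_forall fun x =>
      (measurable_herglotzRieszKernel_circleMap x).aestronglyMeasurable)
    (integrableOn_herglotzRieszKernel hS hS' hK hSK hw)
    (Measurable.aestronglyMeasurable (by fun_prop)) ?_ (integrableOn_const hfin.ne) ?_).2.differentiableAt
  · filter_upwards [ae_restrict_mem hS] with t ht x hx
    rw [norm_div, norm_pow, norm_mul]
    simp only [norm_circleMap_zero, abs_one, mul_one, Complex.norm_ofNat]
    have := h x hx t ht
    gcongr
  · filter_upwards [ae_restrict_mem hS] with t ht x hx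
    have hne : circleMap 0 1 t - x ≠ 0 := by
      intro h0
      have := h x hx t ht
      rw [h0, norm_zero] at this
      linarith
    simp only [herglotzRieszKernel, sub_zero]
    have h1 : HasDerivAt (fun y : ℂ => circleMap 0 1 t + y) 1 x := (hasDerivAt_id x).const_add _
    have h2 : HasDerivAt (fun y : ℂ => circleMap 0 1 t - y) (-1) x := (hasDerivAt_id x).const_sub _
    exact (h1.div h2 hne).congr_deriv (by congr 1; ring)

theorem abs_re_herglotzTransform_le (hS : MeasurableSet S)
    (hS' : S ⊆ Set.Ico 0 (2 * π)) (hK : IsClosed K)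
    (hSK : ∀ t ∈ S, circleMap 0 1 t ∈ K) (hw : w ∉ K) :
    |(herglotzTransform S w).re| ≤ 2 * π := by
  have h := abs_setIntegral_poissonKernel_le hS' w
  rw [poissonKernel_eq_re_herglotzRieszKernel] at h
  convert h using 2
  exact (integral_re (𝕜 := ℂ) (integrableOn_herglotzRieszKernel hS hS' hK hSK hw)).symm

theorem herglotzTransform_zero : herglotzTransform S 0 = volume.real S := by
  have : ∀ t : ℝ, herglotzRieszKernel 0 0 (circleMap 0 1 t) = 1 := fun t => by
    have : circleMap 0 1 t ≠ 0 := circleMap_ne_center one_ne_zero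
    simp [herglotzRieszKernel, this]
  simp [herglotzTransform, this]

theorem norm_herglotzTransform_add_le (hS : MeasurableSet S)
    (hS' : S ⊆ Set.Ico 0 (2 * π)) (hw : 2 ≤ ‖w‖) :
    ‖herglotzTransform S w + volume.real S‖ ≤ 4 * π / (‖w‖ - 1) := by
  have hfin : volume S < ⊤ := (measure_mono hS').trans_lt measure_Ico_lt_top
  have hne : ∀ t : ℝ, ‖w‖ - 1 ≤ ‖circleMap 0 1 t - w‖ := fun t => by
    have := norm_sub_norm_le w (circleMap 0 1 t)
    rw [norm_sub_rev w] at this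
    simpa using this
  have hint : IntegrableOn (fun t => herglotzRieszKernel 0 w (circleMap 0 1 t)) S :=
    integrableOn_herglotzRieszKernel (K := Metric.sphere 0 1) hS hS' Metric.isClosed_sphere
      (by simp) (by simp; linarith)
  have heq : herglotzTransform S w + volume.real S =
      ∫ t in S, (herglotzRieszKernel 0 w (circleMap 0 1 t) + 1) := by
    rw [integral_add hint (integrableOn_const hfin.ne)]
    simp [herglotzTransform]
  rw [heq]
  refine (norm_setIntegral_le_of_norm_le_const (C := 2 / (‖w‖ - 1)) hfin fun t ht => ?_).trans ?_
  · have h0 : circleMap 0 1 t - w ≠ 0 := by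
      intro h
      have := hne t
      rw [h, norm_zero] at this
      linarith
    have : herglotzRieszKernel 0 w (circleMap 0 1 t) + 1 =
        2 * circleMap 0 1 t / (circleMap 0 1 t - w) := by
      simp only [herglotzRieszKernel, sub_zero]
      field_simp; ring
    rw [this, norm_div, norm_mul]
    simp only [norm_circleMap_zero, abs_one, mul_one, Complex.norm_ofNat]
    exact div_le_div_of_nonneg_left (by norm_num) (by linarith) (hne t)
  · have hv : volume.real S ≤ 2 * π := by
      have := measureReal_mono hS' (μ := volume) measure_Ico_lt_top.ne
      simpa [pi_pos.le] using this
    have : 0 < ‖w‖ - 1 := by linarith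
    rw [div_mul_eq_mul_div]
    exact div_le_div_of_nonneg_right (by linarith) this.le
end

/-- A holomorphic function off the arc set parametrized by `S`. For `0 < θ < |S| / 4` it is bounded
by `1`, vanishes at infinity and has modulus `sin θ` at `0`. -/
noncomputable def arcFunction (S : Set ℝ) (θ : ℝ) (w : ℂ) : ℂ :=
  (Complex.exp (Complex.I * (θ / volume.real S : ℝ) * herglotzTransform S w) -
      Complex.exp (-(θ * Complex.I))) /
    (Complex.exp (Complex.I * (θ / volume.real S : ℝ) * herglotzTransform S w) +
      Complex.exp (θ * Complex.I))

section
variable {S : Set ℝ} {K : Set ℂ} {w : ℂ} {θ : ℝ}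

theorem volume_real_le_two_pi (hS' : S ⊆ Set.Ico 0 (2 * π)) : volume.real S ≤ 2 * π := by
  have := measureReal_mono hS' (μ := volume) measure_Ico_lt_top.ne
  simpa [pi_pos.le] using this

theorem re_exp_herglotzTransform_nonneg (hS : MeasurableSet S)
    (hS' : S ⊆ Set.Ico 0 (2 * π)) (hK : IsClosed K)
    (hSK : ∀ t ∈ S, circleMap 0 1 t ∈ K) (hθ : 0 < θ) (hθS : θ < volume.real S / 4)
    (hw : w ∉ K) :
    0 ≤ (Complex.exp (Complex.I * (θ / volume.real S : ℝ) * herglotzTransform S w)).re := by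
  have hb := abs_re_herglotzTransform_le hS hS' hK hSK hw
  have hpos : 0 < volume.real S := by linarith
  have hr : θ / volume.real S ≤ 1 / 4 := by rw [div_le_iff₀ hpos]; linarith
  have hr0 : 0 < θ / volume.real S := by positivity
  rw [Complex.exp_re]
  refine mul_nonneg (exp_pos _).le (cos_nonneg_of_mem_Icc ?_)
  have him : (Complex.I * (θ / volume.real S : ℝ) * herglotzTransform S w).im =
      θ / volume.real S * (herglotzTransform S w).re := by
    rw [mul_assoc, Complex.I_mul_im, Complex.re_ofReal_mul]
  rw [him, Set.mem_Icc, ← abs_le, abs_mul, abs_of_pos hr0]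
  calc θ / volume.real S * |(herglotzTransform S w).re| ≤ 1 / 4 * (2 * π) := by gcongr
    _ = π / 2 := by ring

theorem cos_le_norm_arcFunction_denom (hS : MeasurableSet S)
    (hS' : S ⊆ Set.Ico 0 (2 * π)) (hK : IsClosed K)
    (hSK : ∀ t ∈ S, circleMap 0 1 t ∈ K) (hθ : 0 < θ) (hθS : θ < volume.real S / 4)
    (hw : w ∉ K) :
    cos θ ≤ ‖Complex.exp (Complex.I * (θ / volume.real S : ℝ) * herglotzTransform S w) +
      Complex.exp (θ * Complex.I)‖ := by
  have h := re_exp_herglotzTransform_nonneg hS hS' hK hSK hθ hθS hw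
  refine le_trans ?_ (Complex.re_le_norm _)
  rw [Complex.add_re, Complex.exp_ofReal_mul_I_re]
  linarith

theorem cos_pos_of_lt_volume (hS' : S ⊆ Set.Ico 0 (2 * π)) (hθ : 0 < θ)
    (hθS : θ < volume.real S / 4) : 0 < cos θ := by
  have := volume_real_le_two_pi hS'
  exact cos_pos_of_mem_Ioo ⟨by linarith [pi_pos], by linarith⟩

theorem differentiableAt_arcFunction (hS : MeasurableSet S)
    (hS' : S ⊆ Set.Ico 0 (2 * π)) (hK : IsClosed K)
    (hSK : ∀ t ∈ S, circleMap 0 1 t ∈ K) (hθ : 0 < θ) (hθS : θ < volume.real S / 4)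
    (hw : w ∉ K) : DifferentiableAt ℂ (arcFunction S θ) w := by
  have hd := differentiableAt_herglotzTransform hS hS' hK hSK hw
  have hden := (cos_pos_of_lt_volume hS' hθ hθS).trans_le
    (cos_le_norm_arcFunction_denom hS hS' hK hSK hθ hθS hw)
  have he := (hd.const_mul (Complex.I * (θ / volume.real S : ℝ))).cexp
  exact (he.sub_const _).div (he.add_const _) (norm_pos_iff.1 hden)

theorem norm_arcFunction_le_one (hS : MeasurableSet S)
    (hS' : S ⊆ Set.Ico 0 (2 * π)) (hK : IsClosed K)
    (hSK : ∀ t ∈ S, circleMap 0 1 t ∈ K) (hθ : 0 < θ) (hθS : θ < volume.real S / 4)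
    (hw : w ∉ K) : ‖arcFunction S θ w‖ ≤ 1 := by
  rw [arcFunction, norm_div]
  refine div_le_one_of_le₀ ?_ (norm_nonneg _)
  have h := re_exp_herglotzTransform_nonneg hS hS' hK hSK hθ hθS hw
  have hc := cos_pos_of_lt_volume hS' hθ hθS
  set e := Complex.exp (Complex.I * (θ / volume.real S : ℝ) * herglotzTransform S w)
  have h1 : Complex.exp (-(θ * Complex.I)) = ⟨cos θ, -sin θ⟩ := by
    rw [← neg_mul, ← Complex.ofReal_neg]
    apply Complex.ext
    · rw [Complex.exp_ofReal_mul_I_re, cos_neg]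
    · rw [Complex.exp_ofReal_mul_I_im, sin_neg]
  have h2 : Complex.exp (θ * Complex.I) = ⟨cos θ, sin θ⟩ := by
    apply Complex.ext
    · rw [Complex.exp_ofReal_mul_I_re]
    · rw [Complex.exp_ofReal_mul_I_im]
  rw [h1, h2, ← sq_le_sq₀ (norm_nonneg _) (norm_nonneg _), ← Complex.normSq_eq_norm_sq,
    ← Complex.normSq_eq_norm_sq, Complex.normSq_apply, Complex.normSq_apply]
  simp only [Complex.sub_re, Complex.sub_im, Complex.add_re, Complex.add_im]
  nlinarith [mul_nonneg h hc.le]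

theorem norm_arcFunction_zero (hθ : 0 < θ) (hθS : θ < volume.real S / 4)
    (hS' : S ⊆ Set.Ico 0 (2 * π)) : ‖arcFunction S θ 0‖ = sin θ := by
  have hpos : (0 : ℝ) < volume.real S := by linarith
  have hle := volume_real_le_two_pi hS'
  have hsin : 0 < sin θ := sin_pos_of_pos_of_lt_pi hθ (by linarith [pi_pos])
  have h0 : Complex.I * (θ / volume.real S : ℝ) * herglotzTransform S 0 = θ * Complex.I := by
    rw [herglotzTransform_zero, mul_assoc, ← Complex.ofReal_mul, div_mul_cancel₀ _ hpos.ne',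
      mul_comm]
  rw [arcFunction, h0, norm_div, ← two_mul, norm_mul, Complex.norm_exp_ofReal_mul_I]
  have h2 : Complex.exp (θ * Complex.I) - Complex.exp (-(θ * Complex.I)) =
      ((2 * sin θ : ℝ) : ℂ) * Complex.I := by
    rw [← neg_mul, Complex.exp_mul_I, Complex.exp_mul_I, Complex.cos_neg, Complex.sin_neg]
    push_cast
    ring
  rw [h2, norm_mul, Complex.norm_real, Complex.norm_I, norm_of_nonneg (by linarith)]
  simp

theorem exists_norm_arcFunction_le (hS : MeasurableSet S)
    (hS' : S ⊆ Set.Ico 0 (2 * π)) (hθ : 0 < θ) (hθS : θ < volume.real S / 4) :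
    ∃ C R : ℝ, ∀ w : ℂ, R ≤ ‖w‖ → ‖arcFunction S θ w‖ ≤ C / ‖w‖ := by
  have hpos : (0 : ℝ) < volume.real S := by linarith
  have hc := cos_pos_of_lt_volume hS' hθ hθS
  have hr : θ / volume.real S ≤ 1 / 4 := by rw [div_le_iff₀ hpos]; linarith
  have hr0 : 0 < θ / volume.real S := by positivity
  refine ⟨4 * π / cos θ, 2 + 2 * π, fun w hw => ?_⟩
  have hw2 : 2 ≤ ‖w‖ := by linarith [pi_pos]
  have hwK : w ∉ Metric.sphere (0 : ℂ) 1 := by simp; linarith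
  have hden := cos_le_norm_arcFunction_denom hS hS' Metric.isClosed_sphere
    (K := Metric.sphere (0 : ℂ) 1) (by simp) hθ hθS hwK
  have hΦ := norm_herglotzTransform_add_le hS hS' hw2
  set x : ℂ := Complex.I * (θ / volume.real S : ℝ) *
    (herglotzTransform S w + volume.real S) with hx
  have hxn : ‖x‖ ≤ 2 * π / ‖w‖ := by
    rw [hx, norm_mul, norm_mul, Complex.norm_I, Complex.norm_real, norm_of_nonneg hr0.le, one_mul]
    calc θ / volume.real S * ‖herglotzTransform S w + volume.real S‖
        ≤ 1 / 4 * (4 * π / (‖w‖ - 1)) := by gcongr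
      _ = π / (‖w‖ - 1) := by ring
      _ ≤ 2 * π / ‖w‖ := by
        rw [div_le_div_iff₀ (by linarith) (by linarith)]
        nlinarith [pi_pos]
  have hx1 : ‖x‖ ≤ 1 := hxn.trans (by rw [div_le_one (by linarith)]; linarith)
  have hsplit : Complex.I * (θ / volume.real S : ℝ) * herglotzTransform S w =
      x + -(θ * Complex.I) := by
    have hne : (volume.real S : ℂ) ≠ 0 := by exact_mod_cast hpos.ne'
    rw [hx]; push_cast; field_simp; ring
  have hnum : ‖Complex.exp (Complex.I * (θ / volume.real S : ℝ) * herglotzTransform S w) -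
      Complex.exp (-(θ * Complex.I))‖ ≤ 4 * π / ‖w‖ := by
    rw [hsplit, Complex.exp_add, ← sub_one_mul, norm_mul, ← neg_mul, ← Complex.ofReal_neg,
      Complex.norm_exp_ofReal_mul_I, mul_one]
    calc ‖Complex.exp x - 1‖ ≤ 2 * ‖x‖ := Complex.norm_exp_sub_one_le hx1
      _ ≤ 2 * (2 * π / ‖w‖) := by gcongr
      _ = 4 * π / ‖w‖ := by ring
  rw [arcFunction, norm_div, div_right_comm]
  exact div_le_div₀ (by positivity) hnum hc hden

end

open Polynomial Filter Topology in
theorem exists_norm_eval_mul_pow_le_one {Q : ℂ[X]} {N : ℕ} (hQ : Q.natDegree ≤ N) {g : ℂ → ℂ}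
    {C R : ℝ} (hg : ∀ w : ℂ, R ≤ ‖w‖ → ‖g w‖ ≤ C / ‖w‖) :
    ∃ R' : ℝ, 1 < R' ∧ ∀ w : ℂ, ‖w‖ = R' → ‖Q.eval w * g w ^ (N + 1)‖ ≤ 1 := by
  set M : ℝ := ∑ i ∈ Finset.range (N + 1), ‖Q.coeff i‖ with hM
  have hM0 : 0 ≤ M := Finset.sum_nonneg fun _ _ => norm_nonneg _
  set R' : ℝ := max (max 2 R) (M * |C| ^ (N + 1)) with hR'
  have h2 : 2 ≤ R' := (le_max_left _ _).trans (le_max_left _ _)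
  refine ⟨R', by linarith, fun w hw => ?_⟩
  have hQw : ‖Q.eval w‖ ≤ M * R' ^ N := by
    rw [eval_eq_sum_range' (Nat.lt_succ_of_le hQ), hM, Finset.sum_mul]
    refine (norm_sum_le _ _).trans (Finset.sum_le_sum fun i hi => ?_)
    rw [norm_mul, norm_pow, hw]
    gcongr
    · linarith
    · exact Nat.le_of_lt_succ (Finset.mem_range.1 hi)
  have hgw : ‖g w‖ ≤ |C| / R' := by
    rw [← hw]
    refine (hg w (hw ▸ (le_max_right _ _).trans (le_max_left _ _))).trans ?_
    gcongr
    exact le_abs_self C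
  rw [norm_mul, norm_pow]
  calc ‖Q.eval w‖ * ‖g w‖ ^ (N + 1) ≤ M * R' ^ N * (|C| / R') ^ (N + 1) := by gcongr
    _ = M * |C| ^ (N + 1) / R' := by
      have : R' ≠ 0 := by linarith
      rw [div_pow]
      field_simp
      ring
    _ ≤ 1 := by
      rw [div_le_one (by linarith)]
      exact le_max_right _ _

open Polynomial in
/-- If a polynomial of degree at most `N` is bounded by `1` on the arc set parametrized by `S`, then
its value at `0` is at most `(1 / sin θ) ^ (N + 1)` for every `θ < |S| / 4`. -/
theorem norm_eval_zero_mul_sin_pow_le_one {Q : ℂ[X]} {N : ℕ} (hQ : Q.natDegree ≤ N)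
    {S : Set ℝ} (hS : MeasurableSet S) (hS' : S ⊆ Set.Ico 0 (2 * π))
    (hQS : ∀ t ∈ S, ‖Q.eval (circleMap 0 1 t)‖ ≤ 1) {θ : ℝ} (hθ : 0 < θ)
    (hθS : θ < volume.real S / 4) : ‖Q.eval 0‖ * sin θ ^ (N + 1) ≤ 1 := by
  set K : Set ℂ := {w | ‖w‖ = 1 ∧ ‖Q.eval w‖ ≤ 1} with hKdef
  have hQc : Continuous fun w : ℂ => ‖Q.eval w‖ := Q.continuous.norm
  have hK : IsClosed K :=
    (isClosed_eq continuous_norm continuous_const).inter (isClosed_le hQc continuous_const)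
  have hSK : ∀ t ∈ S, circleMap 0 1 t ∈ K := fun t ht => ⟨by simp, hQS t ht⟩
  obtain ⟨C, R₀, hC⟩ := exists_norm_arcFunction_le hS hS' hθ hθS
  obtain ⟨R, hR1, hR⟩ := exists_norm_eval_mul_pow_le_one hQ hC
  set F : ℂ → ℂ := fun w => Q.eval w * arcFunction S θ w ^ (N + 1) with hF
  have hF0 : ‖F 0‖ = ‖Q.eval 0‖ * sin θ ^ (N + 1) := by
    rw [hF]; simp only [norm_mul, norm_pow, norm_arcFunction_zero hθ hθS hS']
  rw [← hF0]
  refine le_of_forall_pos_le_add fun ε₀ hε₀ => ?_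
  set ε : ℝ := min ε₀ (1 / 2) with hε
  have hεpos : 0 < ε := lt_min hε₀ (by norm_num)
  have hε1 : ε ≤ 1 / 2 := min_le_right _ _
  suffices h : ‖F 0‖ ≤ 1 + ε by linarith [min_le_left ε₀ (1 / 2 : ℝ)]
  set V : Set ℂ := {w | ‖Q.eval w‖ ≤ 1 + ε ∧ 1 - ε ≤ ‖w‖ ∧ ‖w‖ ≤ 1 + ε} with hV
  have hVc : IsClosed V :=
    (isClosed_le hQc continuous_const).inter
      ((isClosed_le continuous_const continuous_norm).inter
        (isClosed_le continuous_norm continuous_const))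
  set U : Set ℂ := Metric.ball 0 R \ V with hU
  have hUo : IsOpen U := Metric.isOpen_ball.sdiff hVc
  have hUb : Bornology.IsBounded U := Metric.isBounded_ball.subset Set.sdiff_subset
  have hcl : closure U ⊆ {w | 1 + ε ≤ ‖Q.eval w‖ ∨ ‖w‖ ≤ 1 - ε ∨ 1 + ε ≤ ‖w‖} := by
    refine closure_minimal ?_ ((isClosed_le continuous_const hQc).union
      ((isClosed_le continuous_norm continuous_const).union
        (isClosed_le continuous_const continuous_norm)))
    rintro w ⟨-, hw⟩
    by_contra! h
    simp only [Set.mem_ofPred_eq, not_or, not_le] at h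
    exact hw ⟨h.1.le, h.2.1.le, h.2.2.le⟩
  have hclK : ∀ w ∈ closure U, w ∉ K := by
    rintro w hw ⟨h1, h2⟩
    rcases hcl hw with h | h | h <;> linarith
  have hdiff : ∀ w ∈ closure U, DifferentiableAt ℂ F w := fun w hw =>
    Q.differentiableAt.mul
      ((differentiableAt_arcFunction hS hS' hK hSK hθ hθS (hclK w hw)).pow _)
  have hdc : DiffContOnCl ℂ F U :=
    DifferentiableOn.diffContOnCl fun w hw => (hdiff w hw).differentiableWithinAt
  refine Complex.norm_le_of_forall_mem_frontier_norm_le hUb hdc (fun w hw => ?_)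
    (subset_closure ⟨by simp; linarith, fun h => ?_⟩)
  · have hwc : w ∈ closure U := frontier_subset_closure hw
    have hwU : w ∉ U := by
      rw [hUo.frontier_eq] at hw
      exact hw.2
    have hwR : ‖w‖ ≤ R := by
      have := Metric.closure_ball_subset_closedBall (closure_mono Set.sdiff_subset hwc)
      simpa using this
    rcases hwR.eq_or_lt with h | h
    · exact (hR w h).trans (by linarith)
    · have hwV : w ∈ V := by
        by_contra hv
        exact hwU ⟨by simpa using h, hv⟩
      have h1 := norm_arcFunction_le_one hS hS' hK hSK hθ hθS (hclK w hwc)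
      rw [hF]
      simp only [norm_mul, norm_pow]
      calc ‖Q.eval w‖ * ‖arcFunction S θ w‖ ^ (N + 1) ≤ (1 + ε) * 1 := by
            gcongr
            · exact hwV.1
            · exact pow_le_one₀ (norm_nonneg _) h1
        _ = 1 + ε := mul_one _
  · have := h.2.1
    rw [norm_zero] at this
    linarith

open Polynomial in
/-- The homogenization `q ^ k * T_k (p / q)` of the Chebyshev polynomials. -/
noncomputable def chebyshevHomogenization (p q : ℂ[X]) : ℕ → ℂ[X]
  | 0 => 1
  | 1 => p
  | k + 2 => 2 * p * chebyshevHomogenization p q (k + 1) - q ^ 2 * chebyshevHomogenization p q k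

namespace chebyshevHomogenization
open Polynomial

variable {p q : ℂ[X]}

theorem eval_eq {z c : ℂ} {x : ℝ} (hq : q.eval z = c) (hp : p.eval z = c * x) (k : ℕ) :
    (chebyshevHomogenization p q k).eval z = c ^ k * ((Chebyshev.T ℝ k).eval x : ℝ) := by
  induction k using Nat.twoStepInduction with
  | zero => simp [chebyshevHomogenization]
  | one => simp [chebyshevHomogenization, hp]
  | more k h0 h1 =>
    rw [chebyshevHomogenization, eval_sub, eval_mul, eval_mul, eval_mul, h0, h1, eval_pow, hp, hq]
    have : Chebyshev.T ℝ ((k + 2 : ℕ) : ℤ) =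
        2 * X * Chebyshev.T ℝ ((k + 1 : ℕ) : ℤ) - Chebyshev.T ℝ (k : ℤ) := by
      exact_mod_cast Chebyshev.T_add_two ℝ (k : ℤ)
    rw [this]
    simp
    ring

theorem natDegree_le {N : ℕ} (hp : p.natDegree ≤ N) (hq : q.natDegree ≤ N) (k : ℕ) :
    (chebyshevHomogenization p q k).natDegree ≤ N * k := by
  induction k using Nat.twoStepInduction with
  | zero => simp [chebyshevHomogenization]
  | one => simpa [chebyshevHomogenization] using hp
  | more k h0 h1 =>
    rw [chebyshevHomogenization]
    refine (natDegree_sub_le _ _).trans (max_le ?_ ?_)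
    · have h2 : (2 * p : ℂ[X]).natDegree ≤ N :=
        (natDegree_C_mul_le (2 : ℂ) p).trans hp
      refine natDegree_mul_le.trans ((Nat.add_le_add h2 h1).trans (le_of_eq (by ring)))
    · have h2 : (q ^ 2).natDegree ≤ 2 * N := natDegree_pow_le.trans (by gcongr)
      refine natDegree_mul_le.trans ((Nat.add_le_add h2 h0).trans (le_of_eq (by ring)))

theorem eval_zero_succ (hq : q.eval 0 = 0) (k : ℕ) :
    (chebyshevHomogenization p q (k + 1)).eval 0 = 2 ^ k * p.eval 0 ^ (k + 1) := by
  induction k with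
  | zero => simp [chebyshevHomogenization]
  | succ k ih =>
    rw [chebyshevHomogenization, eval_sub, eval_mul, eval_mul, eval_mul, ih, eval_pow, hq]
    simp
    ring

end chebyshevHomogenization

open Polynomial in
/-- The polynomial `p` of degree at most `2n` with `p (e^{it}) = e^{int} f(t)`. -/
noncomputable def trigPolynomial (n : ℕ) (a b : ℕ → ℝ) : ℂ[X] :=
  C ((a 0 : ℂ) / 2) * X ^ n + ∑ k ∈ Finset.Icc 1 n,
    (C (((a k : ℂ) - b k * Complex.I) / 2) * X ^ (n + k) +
      C (((a k : ℂ) + b k * Complex.I) / 2) * X ^ (n - k))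

namespace trigPolynomial
open Polynomial

variable {n : ℕ} {a b : ℕ → ℝ}

theorem natDegree_le : (trigPolynomial n a b).natDegree ≤ 2 * n := by
  unfold trigPolynomial
  refine natDegree_add_le_of_degree_le ((natDegree_C_mul_X_pow_le _ _).trans (by omega)) ?_
  refine natDegree_sum_le_of_forall_le _ _ fun k hk => ?_
  have := (Finset.mem_Icc.1 hk).2
  exact natDegree_add_le_of_degree_le ((natDegree_C_mul_X_pow_le _ _).trans (by omega))
    ((natDegree_C_mul_X_pow_le _ _).trans (by omega))

theorem eval_circleMap (t : ℝ) :
    (trigPolynomial n a b).eval (circleMap 0 1 t) = circleMap 0 1 t ^ n *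
      ((a 0 / 2 + ∑ k ∈ Finset.Icc 1 n, (a k * cos (k * t) + b k * sin (k * t)) : ℝ) : ℂ) := by
  rw [trigPolynomial, eval_add, eval_finsetSum]
  simp only [eval_add, eval_mul, eval_C, eval_pow, eval_X]
  push_cast
  rw [mul_add, Finset.mul_sum]
  congr 1
  · ring
  refine Finset.sum_congr rfl fun k hk => ?_
  have hkn := (Finset.mem_Icc.1 hk).2
  have hz : circleMap 0 1 t ≠ 0 := circleMap_ne_center one_ne_zero
  set z := circleMap 0 1 t with hzdef
  have hzk : z ^ k = Complex.cos (k * t) + Complex.sin (k * t) * Complex.I := by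
    rw [← Complex.exp_mul_I, hzdef, circleMap_zero, Complex.ofReal_one, one_mul,
      ← Complex.exp_nat_mul, mul_assoc]
  have h1 : z ^ (n + k) = z ^ n * (Complex.cos (k * t) + Complex.sin (k * t) * Complex.I) := by
    rw [pow_add, hzk]
  have hinv : (Complex.cos (k * t) + Complex.sin (k * t) * Complex.I) *
      (Complex.cos (k * t) - Complex.sin (k * t) * Complex.I) = 1 := by
    linear_combination Complex.sin_sq_add_cos_sq (k * t : ℂ) -
      Complex.sin (k * t) ^ 2 * Complex.I_sq
  have h2 : z ^ (n - k) = z ^ n * (Complex.cos (k * t) - Complex.sin (k * t) * Complex.I) := by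
    have h3 : z ^ n = z ^ (n - k) * z ^ k := by rw [← pow_add, Nat.sub_add_cancel hkn]
    rw [h3, mul_assoc, hzk, hinv, mul_one]
  rw [h1, h2]
  linear_combination -z ^ n * b k * Complex.sin (k * t) * Complex.I_sq

theorem eval_zero (hn : 1 ≤ n) :
    (trigPolynomial n a b).eval 0 = ((a n : ℂ) + b n * Complex.I) / 2 := by
  rw [trigPolynomial, eval_add, eval_finsetSum, Finset.sum_eq_single_of_mem n (by simp [hn])]
  · have hn0 : n ≠ 0 := by omega
    have hnn : n + n ≠ 0 := by omega
    simp [zero_pow hn0, zero_pow hnn]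
  · intro k hk hkn
    have := Finset.mem_Icc.1 hk
    have hadd : n + k ≠ 0 := by omega
    have hsub : n - k ≠ 0 := by omega
    simp [zero_pow hadd, zero_pow hsub]

theorem norm_eval_zero (hn : 1 ≤ n) :
    ‖(trigPolynomial n a b).eval 0‖ = √(a n ^ 2 + b n ^ 2) / 2 := by
  rw [eval_zero hn, norm_div, Complex.norm_add_mul_I]
  simp

end trigPolynomial

open Polynomial in
theorem sqrt_mul_sin_pow_le_one_of_lt {n : ℕ} (hn : 1 ≤ n) {a b : ℕ → ℝ} {S : Set ℝ}
    (hS : MeasurableSet S) (hS' : S ⊆ Set.Ico 0 (2 * π))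
    (hf : ∀ t ∈ S,
      |a 0 / 2 + ∑ k ∈ Finset.Icc 1 n, (a k * cos (k * t) + b k * sin (k * t))| ≤ 1)
    {θ : ℝ} (hθ : 0 < θ) (hθS : θ < volume.real S / 4) :
    √(a n ^ 2 + b n ^ 2) * sin θ ^ (2 * n) ≤ 1 := by
  set A := √(a n ^ 2 + b n ^ 2) with hA
  have hle := volume_real_le_two_pi hS'
  have hs : 0 < sin θ := sin_pos_of_pos_of_lt_pi hθ (by linarith [pi_pos])
  have key : ∀ k : ℕ, (A * sin θ ^ (2 * n)) ^ (k + 1) ≤ 2 / sin θ := by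
    intro k
    have h := norm_eval_zero_mul_sin_pow_le_one
      (Q := chebyshevHomogenization (trigPolynomial n a b) (X ^ n) (k + 1)) (N := 2 * n * (k + 1))
      (chebyshevHomogenization.natDegree_le trigPolynomial.natDegree_le (by simp; omega) _)
      hS hS' (fun t ht => ?_) hθ hθS
    · rw [chebyshevHomogenization.eval_zero_succ (by simp; omega), norm_mul,
        norm_pow, norm_pow, trigPolynomial.norm_eval_zero hn, ← hA, Complex.norm_ofNat] at h
      rw [le_div_iff₀ hs]
      calc (A * sin θ ^ (2 * n)) ^ (k + 1) * sin θ
          = 2 * (2 ^ k * (A / 2) ^ (k + 1) * sin θ ^ (2 * n * (k + 1) + 1)) := by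
            rw [div_pow, mul_pow, ← pow_mul, pow_succ (2 : ℝ) k]; field_simp; ring
        _ ≤ 2 := by linarith
    · rw [chebyshevHomogenization.eval_eq (by simp) (trigPolynomial.eval_circleMap t), norm_mul,
        norm_pow, norm_pow]
      simp only [norm_circleMap_zero, abs_one, one_pow, one_mul, Complex.norm_real]
      exact Chebyshev.abs_eval_T_real_le_one _ (hf t ht)
  by_contra! hlt
  obtain ⟨k, hk⟩ := pow_unbounded_of_one_lt (2 / sin θ) hlt
  exact absurd (key k) (not_le.2 (hk.trans_le (pow_le_pow_right₀ hlt.le (Nat.le_succ k))))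

theorem sqrt_mul_sin_pow_le_one {n : ℕ} (hn : 1 ≤ n) {a b : ℕ → ℝ} {S : Set ℝ}
    (hS : MeasurableSet S) (hS' : S ⊆ Set.Ico 0 (2 * π))
    (hf : ∀ t ∈ S,
      |a 0 / 2 + ∑ k ∈ Finset.Icc 1 n, (a k * cos (k * t) + b k * sin (k * t))| ≤ 1) :
    √(a n ^ 2 + b n ^ 2) * sin (volume.real S / 4) ^ (2 * n) ≤ 1 := by
  rcases (measureReal_nonneg (μ := volume) (s := S)).eq_or_lt with h0 | hpos
  · rw [← h0, zero_div, sin_zero, zero_pow (by omega), mul_zero]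
    exact zero_le_one
  have hc : Continuous fun θ : ℝ => √(a n ^ 2 + b n ^ 2) * sin θ ^ (2 * n) := by fun_prop
  have hlim : Filter.Tendsto (fun θ : ℝ => √(a n ^ 2 + b n ^ 2) * sin θ ^ (2 * n))
      (nhdsWithin (volume.real S / 4) (Set.Iio (volume.real S / 4)))
      (nhds (√(a n ^ 2 + b n ^ 2) * sin (volume.real S / 4) ^ (2 * n))) :=
    hc.continuousAt.mono_left nhdsWithin_le_nhds
  refine le_of_tendsto hlim ?_
  filter_upwards [Ioo_mem_nhdsLT (show (0 : ℝ) < volume.real S / 4 by linarith)] with θ hθ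
  exact sqrt_mul_sin_pow_le_one_of_lt hn hS hS' hf hθ.1 hθ.2

theorem volume_real_one_le_abs_mul_cos {n : ℕ} (hn : 1 ≤ n) {A : ℝ} (hA : 1 ≤ A) (φ : ℝ) :
    volume.real {t : ℝ | t ∈ Set.Ico 0 (2 * π) ∧ 1 ≤ |A * cos (n * t - φ)|} =
      4 * arccos (1 / A) := by
  set B : Set ℝ := {x | 1 ≤ |A * cos x|} with hB
  have hBm : MeasurableSet B := measurableSet_le (by fun_prop) (by fun_prop)
  set g : ℝ → ℝ := B.indicator 1 with hg
  have hgper : Function.Periodic g π := fun x => by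
    have : x + π ∈ B ↔ x ∈ B := by simp [hB, cos_add_pi]
    simp only [hg, Set.indicator, this, Pi.one_apply]
  have hgint : ∀ t₁ t₂, IntervalIntegrable g volume t₁ t₂ := fun t₁ t₂ => by
    rw [intervalIntegrable_iff]
    exact (integrableOn_const (C := (1 : ℝ)) (by simp)).indicator hBm
  have hn0 : (n : ℝ) ≠ 0 := by exact_mod_cast (by omega : n ≠ 0)
  have hA0 : 0 < A := by linarith
  have h1 : volume.real {t : ℝ | t ∈ Set.Ico 0 (2 * π) ∧ 1 ≤ |A * cos (n * t - φ)|} =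
      ∫ t in (0 : ℝ)..2 * π, g (n * t - φ) := by
    have hm : MeasurableSet {t : ℝ | 1 ≤ |A * cos (n * t - φ)|} :=
      measurableSet_le (by fun_prop) (by fun_prop)
    have : (fun t => g (n * t - φ)) = {t : ℝ | 1 ≤ |A * cos (n * t - φ)|}.indicator 1 := by
      ext t; simp [hg, hB, Set.indicator]
    rw [intervalIntegral.integral_of_le (by positivity), ← integral_Ico_eq_integral_Ioc, this,
      setIntegral_indicator hm]
    simp
    rfl
  have h2 : ∫ x in (-(π / 2))..(-(π / 2) + π), g x = 2 * arccos (1 / A) := by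
    have hset : Set.Icc (-(π / 2)) (π / 2) ∩ B =
        Set.Icc (-arccos (1 / A)) (arccos (1 / A)) := by
      have hinv : 0 < 1 / A := by positivity
      have hinv1 : 1 / A ≤ 1 := by rw [div_le_one hA0]; exact hA
      have hle : arccos (1 / A) ≤ π / 2 := arccos_le_pi_div_two.2 hinv.le
      ext x
      have hiff : |x| ≤ π / 2 → (x ∈ B ↔ |x| ≤ arccos (1 / A)) := fun hx => by
        have hc : 0 ≤ cos x := cos_nonneg_of_mem_Icc (abs_le.1 hx)
        have : x ∈ B ↔ 1 / A ≤ cos |x| := by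
          rw [cos_abs, div_le_iff₀ hA0]
          simp only [hB, Set.mem_ofPred_eq]
          rw [abs_of_nonneg (by positivity), mul_comm]
        rw [this]
        constructor
        · intro h
          have := arccos_le_arccos h
          rwa [arccos_cos (abs_nonneg x) (by linarith [pi_pos])] at this
        · intro h
          have := cos_le_cos_of_nonneg_of_le_pi (abs_nonneg x) (by linarith [pi_pos]) h
          rwa [cos_arccos (by linarith) hinv1] at this
      rw [Set.mem_inter_iff, Set.mem_Icc, Set.mem_Icc, ← abs_le, ← abs_le]
      constructor
      · rintro ⟨h, hx⟩; exact (hiff h).1 hx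
      · intro h; exact ⟨h.trans hle, (hiff (h.trans hle)).2 h⟩
    rw [show -(π / 2) + π = π / 2 by ring, intervalIntegral.integral_of_le (by linarith [pi_pos]),
      ← integral_Icc_eq_integral_Ioc, hg, setIntegral_indicator hBm, hset]
    simp [arccos_nonneg]
    ring
  have h3 := hgper.intervalIntegral_add_zsmul_eq (2 * n) (-φ) hgint
  rw [hgper.intervalIntegral_add_eq (-φ) (-(π / 2)), h2] at h3
  rw [h1, intervalIntegral.integral_comp_mul_sub _ hn0]
  have : (n : ℝ) * (2 * π) - φ = -φ + (2 * (n : ℤ)) • π := by simp; ring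
  rw [mul_zero, zero_sub, this, h3]
  simp
  field_simp
  ring

theorem volume_real_one_le_abs_mul_cos_add_mul_sin {n : ℕ} (hn : 1 ≤ n) {a b : ℝ}
    (hab : 1 ≤ √(a ^ 2 + b ^ 2)) :
    volume.real {t : ℝ | t ∈ Set.Ico 0 (2 * π) ∧ 1 ≤ |a * cos (n * t) + b * sin (n * t)|} =
      4 * arccos (1 / √(a ^ 2 + b ^ 2)) := by
  set z : ℂ := ⟨a, b⟩ with hz
  have hA : ‖z‖ = √(a ^ 2 + b ^ 2) := by
    have := Complex.norm_add_mul_I a b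
    rwa [← Complex.mk_eq_add_mul_I] at this
  have ha : a = ‖z‖ * cos z.arg := (Complex.norm_mul_cos_arg z).symm
  have hb : b = ‖z‖ * sin z.arg := (Complex.norm_mul_sin_arg z).symm
  rw [← hA] at hab ⊢
  rw [← volume_real_one_le_abs_mul_cos hn hab z.arg]
  congr 1
  ext t
  have : a * cos (n * t) + b * sin (n * t) = ‖z‖ * cos (n * t - z.arg) := by
    rw [cos_sub]
    linear_combination cos (n * t) * ha + sin (n * t) * hb
  simp only [Set.mem_ofPred_eq, this]

theorem abs_mul_cos_add_mul_sin_le (a b x : ℝ) : |a * cos x + b * sin x| ≤ √(a ^ 2 + b ^ 2) := by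
  refine abs_le_sqrt ?_
  nlinarith [sq_nonneg (a * sin x - b * cos x), sin_sq_add_cos_sq x]

theorem volume_real_leading_le {n : ℕ} (hn : 1 ≤ n) (a b : ℕ → ℝ) :
    volume.real {t : ℝ | t ∈ Set.Ico 0 (2 * π) ∧
        1 ≤ |a n * cos (n * t) + b n * sin (n * t)|} ≤
      √(2 * n) * volume.real {t : ℝ | t ∈ Set.Ico 0 (2 * π) ∧
        1 ≤ |a 0 / 2 + ∑ k ∈ Finset.Icc 1 n, (a k * cos (k * t) + b k * sin (k * t))|} := by
  set f : ℝ → ℝ := fun t =>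
    a 0 / 2 + ∑ k ∈ Finset.Icc 1 n, (a k * cos (k * t) + b k * sin (k * t)) with hf
  have hfc : Continuous f := by fun_prop
  set A := √(a n ^ 2 + b n ^ 2) with hA
  rcases lt_or_ge A 1 with hA1 | hA1
  · have : {t : ℝ | t ∈ Set.Ico 0 (2 * π) ∧
        1 ≤ |a n * cos (n * t) + b n * sin (n * t)|} = ∅ := by
      ext t
      simp only [Set.mem_ofPred_eq, Set.mem_empty_iff_false, iff_false, not_and, not_le]
      exact fun _ => (abs_mul_cos_add_mul_sin_le _ _ _).trans_lt hA1
    rw [this, measureReal_empty]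
    positivity
  rw [volume_real_one_le_abs_mul_cos_add_mul_sin hn hA1, ← hA]
  set F : Set ℝ := {t : ℝ | t ∈ Set.Ico 0 (2 * π) ∧ 1 ≤ |f t|} with hF
  set S : Set ℝ := Set.Ico 0 (2 * π) \ F with hS
  have hFsub : F ⊆ Set.Ico 0 (2 * π) := fun t ht => ht.1
  have hFm : MeasurableSet F :=
    measurableSet_Ico.inter (measurableSet_le measurable_const hfc.abs.measurable)
  have hSm : MeasurableSet S := measurableSet_Ico.diff hFm
  have hvol : volume.real S = 2 * π - volume.real F := by
    rw [hS, measureReal_sdiff hFsub hFm measure_Ico_lt_top.ne]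
    simp [pi_pos.le]
  have hmain := sqrt_mul_sin_pow_le_one hn (a := a) (b := b) hSm Set.sdiff_subset fun t ht => by
    by_contra! h
    exact ht.2 ⟨ht.1, h.le⟩
  set θ : ℝ := volume.real F / 4 with hθ
  have hθ0 : 0 ≤ θ := by positivity
  have hsin : sin (volume.real S / 4) = cos θ := by
    rw [← sin_pi_div_two_sub, hvol, hθ]; congr 1; ring
  rw [hsin, ← hA] at hmain
  have hA0 : 0 < A := by linarith
  have hcos : cos θ ^ (2 * n) ≤ 1 / A := by rw [le_div_iff₀ hA0, mul_comm]; exact hmain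
  suffices h : arccos (1 / A) ≤ √(2 * n) * θ by
    rw [hθ] at h; linarith
  rcases le_or_gt (√(2 * n) * θ) (π / 2) with h | h
  · have hle : cos (√(2 * n) * θ) ≤ 1 / A := by
      refine le_trans ?_ hcos
      have := cos_sqrt_mul_le_cos_pow (m := 2 * n) (by omega) hθ0 (by push_cast; exact h)
      push_cast at this
      exact this
    have := arccos_le_arccos hle
    rwa [arccos_cos (by positivity) (by linarith [pi_pos])] at this
  · exact (arccos_le_pi_div_two.2 (by positivity)).trans h.le

theorem volume_real_le_abs_cos_le {θ : ℝ} (hθ0 : 0 ≤ θ) :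
    volume.real {t : ℝ | t ∈ Set.Ico 0 (2 * π) ∧ cos θ ≤ |cos (t / 2)|} ≤ 4 * θ := by
  have hsub : {t : ℝ | t ∈ Set.Ico 0 (2 * π) ∧ cos θ ≤ |cos (t / 2)|} ⊆
      Set.Icc 0 (2 * θ) ∪ Set.Icc (2 * π - 2 * θ) (2 * π) := by
    rintro t ⟨ht, hc⟩
    rcases le_abs.1 hc with h | h
    · left
      refine ⟨ht.1, ?_⟩
      by_contra! hlt
      have := cos_lt_cos_of_nonneg_of_le_pi hθ0 (by linarith [ht.2]) (show θ < t / 2 by linarith)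
      linarith
    · right
      refine ⟨?_, ht.2.le⟩
      by_contra! hlt
      have := cos_lt_cos_of_nonneg_of_le_pi hθ0 (by linarith [ht.1])
        (show θ < π - t / 2 by linarith)
      rw [cos_pi_sub] at this
      linarith
  refine (measureReal_mono hsub (measure_union_lt_top measure_Icc_lt_top
    measure_Icc_lt_top).ne).trans ((measureReal_union_le _ _).trans (le_of_eq ?_))
  rw [Real.volume_real_Icc_of_le (by linarith), Real.volume_real_Icc_of_le (by linarith)]
  ring

open Polynomial in
theorem exists_volume_real_le {n : ℕ} (hn : 1 ≤ n) {θ : ℝ} (hθ0 : 0 < θ) (hθ : θ < π / 2)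
    {A : ℝ} (hA0 : 0 < A) (hA : A * cos θ ^ (2 * n) < 1) :
    ∃ a : ℕ → ℝ, a n = A ∧
      volume.real {t : ℝ | t ∈ Set.Ico 0 (2 * π) ∧
        1 ≤ |a 0 / 2 + ∑ k ∈ Finset.Icc 1 n, a k * cos (k * t)|} ≤ 4 * θ := by
  have hc : 0 < cos θ := cos_pos_of_mem_Ioo ⟨by linarith [pi_pos], hθ⟩
  set s : ℝ := A * cos θ ^ (2 * n) with hs
  have hs0 : 0 < s := by positivity
  set l : ℝ[X] := C (1 / cos θ ^ 2) * X + C (1 / cos θ ^ 2 - 1) with hl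
  have hd : (1 / cos θ ^ 2 : ℝ) ≠ 0 := by positivity
  have hldeg : l.natDegree = 1 := natDegree_linear hd
  have hllc : l.leadingCoeff = 1 / cos θ ^ 2 := leadingCoeff_linear hd
  set T := Chebyshev.T ℝ (n : ℤ) with hT
  have hTdeg : T.natDegree = n := by simp [hT]
  have hTlc : T.leadingCoeff = 2 ^ (n - 1) := by simp [hT]
  set q : ℝ[X] := C s * T.comp l with hq
  have hcompdeg : (T.comp l).natDegree = n := by rw [natDegree_comp, hTdeg, hldeg, mul_one]
  have hqdeg : q.natDegree ≤ n := (natDegree_C_mul_le _ _).trans hcompdeg.le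
  have hqc : q.coeff n = s * (2 ^ (n - 1) * (1 / cos θ ^ 2) ^ n) := by
    rw [hq, coeff_C_mul, ← hTlc, ← hllc]
    congr 1
    have := leadingCoeff_comp (p := T) (q := l) (by rw [hldeg]; exact one_ne_zero)
    rwa [leadingCoeff, hcompdeg, hTdeg] at this
  obtain ⟨a, han, ha⟩ := Polynomial.exists_eval_cos_eq_sum n q hqdeg
  refine ⟨a, ?_, ?_⟩
  · rw [han hn, hqc, hs, div_pow, one_pow, ← pow_mul]
    field_simp
  · refine le_trans (measureReal_mono ?_ ?_) (volume_real_le_abs_cos_le hθ0.le)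
    · rintro t ⟨ht, h1⟩
      refine ⟨ht, ?_⟩
      by_contra! hlt
      rw [← ha t, hq, eval_mul, eval_C, eval_comp, abs_mul, abs_of_pos hs0] at h1
      have hle : |l.eval (cos t)| ≤ 1 := by
        have hcos : cos t = 2 * cos (t / 2) ^ 2 - 1 := by
          rw [← cos_two_mul]; congr 1; ring
        have hev : l.eval (cos t) = 2 * (cos (t / 2) / cos θ) ^ 2 - 1 := by
          rw [hl, hcos]; simp; field_simp; ring
        have hsq : (cos (t / 2) / cos θ) ^ 2 ≤ 1 := by
          rw [div_pow, div_le_one (by positivity), sq_le_sq, abs_of_pos hc]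
          exact hlt.le
        rw [hev, abs_le]
        constructor <;> nlinarith [sq_nonneg (cos (t / 2) / cos θ)]
      have := Chebyshev.abs_eval_T_real_le_one (n : ℤ) hle
      nlinarith [abs_nonneg (T.eval (l.eval (cos t)))]
    · exact ((measure_mono fun t ht => ht.1).trans_lt
        (measure_Ico_lt_top (a := (0 : ℝ)) (b := 2 * π))).ne

theorem two_mul_le_sq_of_cos_le {n : ℕ} {β : ℝ}
    (h : ∀ θ : ℝ, 0 < θ → θ < π / 2 → β * θ ≤ π → cos (β * θ) ≤ cos θ ^ (2 * n)) :
    2 * n ≤ β ^ 2 := by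
  have key : ∀ᶠ θ : ℝ in nhdsWithin 0 (Set.Ioi 0), (n : ℝ) - β ^ 2 / 2 ≤ n * β ^ 2 * θ ^ 2 / 2 := by
    have hsmall : ∀ᶠ θ : ℝ in nhdsWithin 0 (Set.Ioi 0), β * θ < π := by
      have : Filter.Tendsto (fun θ : ℝ => β * θ) (nhds 0) (nhds 0) := by
        have hc : Continuous fun θ : ℝ => β * θ := by fun_prop
        simpa using hc.tendsto 0
      exact (this.mono_left nhdsWithin_le_nhds).eventually_lt_const pi_pos
    filter_upwards [hsmall, Ioo_mem_nhdsGT (show (0 : ℝ) < π / 2 by positivity)] with θ h1 h2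
    have hcos := h θ h2.1 h2.2 h1.le
    have hlow := one_sub_sq_div_two_le_cos (x := β * θ)
    have hup : cos θ ^ (2 * n) ≤ 1 / (1 + n * θ ^ 2) := by
      have hc := cos_le_one_div_sqrt_sq_add_one (x := θ) (by linarith [h2.1, pi_pos])
        (by linarith [h2.2, pi_pos])
      have hc0 : 0 ≤ cos θ := cos_nonneg_of_mem_Icc ⟨by linarith [h2.1, pi_pos], h2.2.le⟩
      have hsq : cos θ ^ 2 ≤ 1 / (θ ^ 2 + 1) := by
        calc cos θ ^ 2 ≤ (1 / √(θ ^ 2 + 1)) ^ 2 := by gcongr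
          _ = 1 / (θ ^ 2 + 1) := by rw [div_pow, sq_sqrt (by positivity), one_pow]
      calc cos θ ^ (2 * n) = (cos θ ^ 2) ^ n := pow_mul _ _ _
        _ ≤ (1 / (θ ^ 2 + 1)) ^ n := by gcongr
        _ = 1 / (θ ^ 2 + 1) ^ n := by rw [div_pow, one_pow]
        _ ≤ 1 / (1 + n * θ ^ 2) := by
          have := one_add_mul_le_pow (a := θ ^ 2) (by nlinarith [sq_nonneg θ]) n
          rw [add_comm 1 (θ ^ 2)] at this
          gcongr
    have hchain := hlow.trans (hcos.trans hup)
    rw [le_div_iff₀ (by positivity)] at hchain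
    have hθ2 : 0 < θ ^ 2 := pow_pos h2.1 2
    have : θ ^ 2 * (n - β ^ 2 / 2) ≤ θ ^ 2 * (n * β ^ 2 * θ ^ 2 / 2) := by nlinarith
    exact le_of_mul_le_mul_left this hθ2
  have hlim : Filter.Tendsto (fun θ : ℝ => n * β ^ 2 * θ ^ 2 / 2) (nhdsWithin 0 (Set.Ioi 0))
      (nhds 0) := by
    have hc : Continuous fun θ : ℝ => n * β ^ 2 * θ ^ 2 / 2 := by fun_prop
    have := hc.tendsto 0
    simp only [ne_eq, OfNat.ofNat_ne_zero, not_false_eq_true, zero_pow, mul_zero, zero_div] at this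
    exact this.mono_left nhdsWithin_le_nhds
  have := ge_of_tendsto hlim key
  linarith

theorem stmt_17 (n : ℕ) (hn : 1 ≤ n) :
    let μ : (ℝ → ℝ) → ℝ := fun f =>
      (volume {t : ℝ | t ∈ Set.Ico 0 (2 * Real.pi) ∧ 1 ≤ |f t|}).toReal
    IsLeast {β : ℝ | ∀ a b : ℕ → ℝ, (a n) ^ 2 + (b n) ^ 2 > 0 →
        μ (fun t => a n * Real.cos (n * t) + b n * Real.sin (n * t)) ≤
          β * μ (fun t => a 0 / 2 +
            ∑ k ∈ Finset.Icc 1 n, (a k * Real.cos (k * t) + b k * Real.sin (k * t)))}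
      (Real.sqrt (2 * n)) := by
  intro μ
  refine ⟨fun a b _ => volume_real_leading_le hn a b, fun β hβ => ?_⟩
  have key : ∀ θ A : ℝ, 0 < θ → θ < π / 2 → 1 ≤ A → A * cos θ ^ (2 * n) < 1 →
      ∃ m : ℝ, 0 ≤ m ∧ m ≤ 4 * θ ∧ 4 * arccos (1 / A) ≤ β * m := by
    intro θ A hθ0 hθ hA1 hA
    obtain ⟨a, han, ha⟩ := exists_volume_real_le hn hθ0 hθ (by linarith) hA
    have hsqrt : √(a n ^ 2 + (0 : ℝ) ^ 2) = A := by
      rw [han, zero_pow two_ne_zero, add_zero, sqrt_sq (by linarith)]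
    have h := hβ a (fun _ => 0) (by rw [han]; positivity)
    refine ⟨_, measureReal_nonneg, ha, ?_⟩
    have hlead := volume_real_one_le_abs_mul_cos_add_mul_sin hn (a := a n) (b := 0)
      (by rw [hsqrt]; exact hA1)
    rw [hsqrt] at hlead
    rw [← hlead]
    simpa [μ, Measure.real] using h
  have hcosn : ∀ θ : ℝ, 0 < θ → θ < π / 2 → 0 < cos θ ^ (2 * n) ∧ cos θ ^ (2 * n) < 1 := by
    intro θ hθ0 hθ
    have hc : 0 < cos θ := cos_pos_of_mem_Ioo ⟨by linarith [pi_pos], hθ⟩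
    have hc1 : cos θ < 1 := by
      simpa using cos_lt_cos_of_nonneg_of_le_pi le_rfl (by linarith [pi_pos]) hθ0
    exact ⟨by positivity, pow_lt_one₀ hc.le hc1 (by omega)⟩
  have hβ0 : 0 ≤ β := by
    obtain ⟨h0, h1⟩ := hcosn 1 one_pos (by linarith [pi_gt_three])
    obtain ⟨A, hA1, hA⟩ := exists_between ((one_lt_div h0).2 h1)
    obtain ⟨m, hm, -, h⟩ := key 1 A one_pos (by linarith [pi_gt_three]) hA1.le
      ((lt_div_iff₀ h0).1 hA)
    have : 0 < arccos (1 / A) := arccos_pos.2 (by rw [div_lt_one (by linarith)]; exact hA1)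
    by_contra! hneg
    nlinarith
  rw [Real.sqrt_le_left hβ0]
  refine two_mul_le_sq_of_cos_le fun θ hθ0 hθ hβθ => ?_
  obtain ⟨h0, h1⟩ := hcosn θ hθ0 hθ
  refine le_of_forall_gt_imp_ge_of_dense fun y hy => ?_
  rcases le_or_gt y 1 with hy1 | hy1
  · have hy0 : 0 < y := h0.trans hy
    obtain ⟨m, hm, hm', h⟩ := key θ (1 / y) hθ0 hθ ((one_le_div hy0).2 hy1)
      (by rw [one_div_mul_eq_div, div_lt_one hy0]; exact hy)
    rw [one_div_one_div] at h
    have hle : arccos y ≤ β * θ := by nlinarith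
    have := cos_le_cos_of_nonneg_of_le_pi (arccos_nonneg y) hβθ hle
    rwa [cos_arccos (by linarith) hy1] at this
  · exact (cos_le_one _).trans hy1.le
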